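/- Let f be a non-constant Boolean function with s_1(f) = 2 and s_0(f) ≥ 5. Then C_0(f) ≤ 2·s_0(f) − 3. -/

import Mathlib

/-- The input `x` with its `i`-th coordinate flipped. -/
def flipCoord {n : ℕ} (x : Fin n → Bool) (i : Fin n) : Fin n → Bool :=
  Function.update x i (!(x i))

/-- The sensitivity `s(f, x)` of a Boolean function `f` on input `x`:
the number of coordinates whose flip changes the value of `f`. -/
def sensAt {n : ℕ} (f : (Fin n → Bool) → Bool) (x : Fin n → Bool) : ℕ :=
  (Finset.univ.filter fun i => f (flipCoord x i) ≠ f x).card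

/-- The `b`-sensitivity `s_b(f)`: the maximum of `s(f, x)` over inputs `x` with `f x = b`. -/
def bSens {n : ℕ} (f : (Fin n → Bool) → Bool) (b : Bool) : ℕ :=
  (Finset.univ.filter fun x => f x = b).sup (sensAt f)

/-- The certificate complexity `C(f, x)`: the minimum size of a set `P` of coordinates
such that fixing the coordinates in `P` to their values in `x` forces the value of `f`. -/
noncomputable def certAt {n : ℕ} (f : (Fin n → Bool) → Bool) (x : Fin n → Bool) : ℕ :=
  sInf {k | ∃ P : Finset (Fin n), P.card = k ∧
    ∀ y : Fin n → Bool, (∀ i ∈ P, y i = x i) → f y = f x}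

/-- The `b`-certificate complexity `C_b(f)`: the maximum of `C(f, x)` over `x` with `f x = b`. -/
noncomputable def bCert {n : ℕ} (f : (Fin n → Bool) → Bool) (b : Bool) : ℕ :=
  (Finset.univ.filter fun x => f x = b).sup (certAt f)

/-- A Boolean function is non-constant if it takes two different values. -/
def NonConstant {n : ℕ} (f : (Fin n → Bool) → Bool) : Prop :=
  ∃ x y, f x ≠ f y

open Finset

lemma flipCoord_apply {n : ℕ} (x : Fin n → Bool) (i j : Fin n) :
    flipCoord x i j = if j = i then !(x i) else x j := by
  simp [flipCoord, Function.update_apply]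

@[simp] lemma flipCoord_flipCoord {n : ℕ} (x : Fin n → Bool) (i : Fin n) :
    flipCoord (flipCoord x i) i = x := by
  ext j; simp only [flipCoord_apply]; grind

lemma flipCoord_comm {n : ℕ} (x : Fin n → Bool) (i j : Fin n) :
    flipCoord (flipCoord x i) j = flipCoord (flipCoord x j) i := by
  ext k; simp only [flipCoord_apply]; grind

/-- A property stable under flipping the coordinates in `L` spreads from `w₀` to every input
agreeing with `w₀` outside `L`. -/
lemma flipCoord_induction {n : ℕ} {Q : (Fin n → Bool) → Prop} {L : Fin n → Prop}
    {w₀ : Fin n → Bool} (h0 : Q w₀) (step : ∀ w l, L l → Q w → Q (flipCoord w l))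
    (w : Fin n → Bool) (hw : ∀ l, ¬ L l → w l = w₀ l) : Q w := by
  induction hc : (univ.filter fun l => w l ≠ w₀ l).card generalizing w with
  | zero =>
    have : w = w₀ := by
      ext l
      by_contra h
      have : l ∈ univ.filter fun l => w l ≠ w₀ l := by simpa using h
      simp [card_eq_zero.mp hc] at this
    exact this ▸ h0
  | succ c ih =>
    obtain ⟨l, hl⟩ : (univ.filter fun l => w l ≠ w₀ l).Nonempty := by
      rw [← card_pos]; omega
    have hl' : w l ≠ w₀ l := by simpa using hl
    have hL : L l := by
      by_contra h
      exact hl' (hw l h)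
    have key : Q (flipCoord w l) := by
      refine ih _ (fun j hj => ?_) ?_
      · rw [flipCoord_apply, if_neg (by rintro rfl; exact hj hL)]
        exact hw j hj
      · have : (univ.filter fun j => flipCoord w l j ≠ w₀ j)
            = (univ.filter fun j => w j ≠ w₀ j).erase l := by
          ext j
          simp only [mem_filter, mem_univ, true_and, mem_erase, flipCoord_apply]
          by_cases hjl : j = l
          · subst hjl
            simpa using hl'
          · simp [hjl]
        rw [this, card_erase_of_mem hl, hc]
        rfl
    simpa using step _ l hL key

/-- The input `w` with the coordinates in `P` reset to their values in `x`. -/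
def resetOn {n : ℕ} (P : Finset (Fin n)) (x w : Fin n → Bool) : Fin n → Bool :=
  fun i => if i ∈ P then x i else w i

lemma resetOn_flipCoord_of_mem {n : ℕ} {P : Finset (Fin n)} (x w : Fin n → Bool) {k : Fin n}
    (hk : k ∈ P) : resetOn P x (flipCoord w k) = resetOn P x w := by
  ext j; simp only [resetOn, flipCoord_apply]; grind

lemma resetOn_flipCoord_of_notMem {n : ℕ} {P : Finset (Fin n)} (x w : Fin n → Bool) {k : Fin n}
    (hk : k ∉ P) : resetOn P x (flipCoord w k) = flipCoord (resetOn P x w) k := by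
  ext j; simp only [resetOn, flipCoord_apply]; grind

lemma resetOn_apply_of_mem {n : ℕ} {P : Finset (Fin n)} (x w : Fin n → Bool) {k : Fin n}
    (hk : k ∈ P) : resetOn P x w k = x k := by
  simp [resetOn, hk]

lemma flipCoord_resetOn_eq {n : ℕ} {P : Finset (Fin n)} {x y : Fin n → Bool} {i : Fin n}
    (hi : y i ≠ x i) (hy : ∀ j ∈ P, j ≠ i → y j = x j) (hiP : i ∈ P) :
    flipCoord (resetOn P x y) i = y := by
  ext j
  rw [flipCoord_apply, resetOn_apply_of_mem x y hiP]
  split_ifs with h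
  · rw [h]
    exact (Bool.eq_not.mpr hi).symm
  · rw [resetOn]
    split_ifs with hj
    · exact (hy j hj h).symm
    · rfl

/-- `g` is a coordinate `k` or its negation. -/
def IsLiteralAt {n : ℕ} (g : (Fin n → Bool) → Bool) (k : Fin n) : Prop :=
  ∀ w, g (flipCoord w k) = !(g w) ∧ ∀ l, l ≠ k → g (flipCoord w l) = g w

lemma isLiteralAt_or_two_le {n : ℕ} {g : (Fin n → Bool) → Bool}
    (h1 : ∀ w, g w = true → ∀ k l, k ≠ l → g (flipCoord w k) = false → g (flipCoord w l) = true)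
    (hne : ∃ w, g w = true) :
    (∃ k, IsLiteralAt g k) ∨ ∀ w, g w = false →
      ∃ k l, k ≠ l ∧ g (flipCoord w k) = true ∧ g (flipCoord w l) = true := by
  refine or_iff_not_imp_right.mpr fun h => ?_
  push Not at h
  obtain ⟨w₀, hw₀, huniq⟩ := h
  have spread : ∀ w, (∀ l, ¬ g (flipCoord w₀ l) = false → w l = w₀ l) →
      g w = false ∧ ∀ l, g (flipCoord w l) = g (flipCoord w₀ l) := by
    refine flipCoord_induction (L := fun l => g (flipCoord w₀ l) = false) ⟨hw₀, fun _ => rfl⟩ ?_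
    rintro w l hl ⟨hw, hwl⟩
    refine ⟨by rw [hwl, hl], fun j => ?_⟩
    by_cases hjl : j = l
    · subst hjl; simp [hw, hl]
    cases hj : g (flipCoord w₀ j)
    · by_contra hc
      have := h1 _ (by simpa using hc) l j (Ne.symm hjl)
        (by rw [flipCoord_comm, flipCoord_flipCoord, hwl, hj])
      simp [hwl, hl] at this
    · have := h1 (flipCoord w j) (by rw [hwl, hj]) j l hjl (by simpa using hw)
      rwa [flipCoord_comm] at this
  by_cases hS : ∃ k, g (flipCoord w₀ k) = true
  · obtain ⟨k, hk⟩ := hS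
    have hl0 : ∀ l, l ≠ k → g (flipCoord w₀ l) = false := fun l hl => by
      simpa using huniq k l (Ne.symm hl) hk
    have same : ∀ w, w k = w₀ k → g w = false ∧ ∀ l, g (flipCoord w l) = g (flipCoord w₀ l) :=
      fun w hw => spread w fun l hl => by
        by_cases hlk : l = k
        · rw [hlk, hw]
        · exact absurd (hl0 l hlk) hl
    have back : ∀ w, w k ≠ w₀ k → flipCoord w k k = w₀ k := fun w hw => by
      rw [flipCoord_apply, if_pos rfl]
      exact (Bool.eq_not.mpr hw.symm).symm
    have opp : ∀ w, w k ≠ w₀ k → g w = true := fun w hw => by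
      have := (same (flipCoord w k) (back w hw)).2 k
      rwa [flipCoord_flipCoord, hk] at this
    refine ⟨k, fun w => ?_⟩
    by_cases hw : w k = w₀ k
    · obtain ⟨ha, hb⟩ := same w hw
      exact ⟨by rw [hb, hk, ha]; rfl, fun l hl => by rw [hb, hl0 l hl, ha]⟩
    · refine ⟨?_, fun l hl => ?_⟩
      · rw [opp w hw, (same (flipCoord w k) (back w hw)).1]; rfl
      · rw [opp w hw, opp]
        rwa [flipCoord_apply, if_neg (Ne.symm hl)]
  · push Not at hS
    obtain ⟨w, hw⟩ := hne
    have := (spread w fun l hl => absurd (by simpa using hS l) hl).1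
    simp [hw] at this

lemma sum_flipCoord {n : ℕ} (φ : (Fin n → Bool) → ℕ) (k : Fin n) :
    ∑ w, φ (flipCoord w k) = ∑ w, φ w :=
  Equiv.sum_comp (Function.Involutive.toPerm (fun w => flipCoord w k)
    fun w => flipCoord_flipCoord w k) φ

lemma card_true_add_card_false {n : ℕ} (g : (Fin n → Bool) → Bool) :
    (univ.filter fun w => g w = true).card + (univ.filter fun w => g w = false).card
      = Fintype.card (Fin n → Bool) := by
  have := card_filter_add_card_filter_not (s := univ) (fun w => g w = true)
  simpa using this

lemma IsLiteralAt.two_mul_card {n : ℕ} {g : (Fin n → Bool) → Bool} {k : Fin n}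
    (h : IsLiteralAt g k) :
    2 * (univ.filter fun w => g w = true).card = Fintype.card (Fin n → Bool) := by
  have := sum_flipCoord (fun w => if g w = true then 1 else 0) k
  simp only [(h _).1, Bool.not_eq_true', ← card_filter] at this
  have h2 := card_true_add_card_false g
  omega

/-- The number of true inputs with a false neighbour is at least twice the number of false inputs,
if each false input has two true neighbours and each true input at most one false neighbour. -/
lemma two_mul_card_false_le {n : ℕ} {g : (Fin n → Bool) → Bool}
    (h1 : ∀ w, g w = true → ∀ k l, k ≠ l → g (flipCoord w k) = false → g (flipCoord w l) = true)
    (h2 : ∀ w, g w = false →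
      ∃ k l, k ≠ l ∧ g (flipCoord w k) = true ∧ g (flipCoord w l) = true) :
    2 * (univ.filter fun w => g w = false).card
      ≤ (univ.filter fun w => g w = true ∧ ∃ k, g (flipCoord w k) = false).card := by
  have lower : 2 * (univ.filter fun w => g w = false).card
      ≤ ∑ w, ∑ k, if g w = false ∧ g (flipCoord w k) = true then 1 else 0 := by
    rw [card_filter, mul_sum]
    refine sum_le_sum fun w _ => ?_
    split_ifs with hw
    · obtain ⟨k, l, hkl, hk, hl⟩ := h2 w hw
      rw [← card_filter, mul_one]
      exact one_lt_card.mpr ⟨k, by simp [hw, hk], l, by simp [hw, hl], hkl⟩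
    · simp
  have swap : (∑ w, ∑ k, if g w = false ∧ g (flipCoord w k) = true then 1 else 0)
      = ∑ w, ∑ k, if g w = true ∧ g (flipCoord w k) = false then 1 else 0 := by
    rw [sum_comm, sum_comm (s := (univ : Finset (Fin n → Bool)))]
    refine sum_congr rfl fun k _ => ?_
    rw [← sum_flipCoord _ k]
    simp only [flipCoord_flipCoord, and_comm]
  rw [swap] at lower
  refine lower.trans ?_
  rw [card_filter]
  refine sum_le_sum fun w _ => ?_
  rw [← card_filter]
  split_ifs with hw
  · refine card_le_one.mpr fun k hk l hl => ?_
    by_contra hkl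
    simp only [mem_filter, mem_univ, true_and] at hk hl
    simpa [hl.2] using h1 w hk.1 k l hkl hk.2
  · rw [Nat.le_zero, card_eq_zero, filter_eq_empty_iff]
    exact fun k _ hk => hw ⟨hk.1, k, hk.2⟩

/-- The value of `f` on the subcube fixed by `P` and `x`, shifted in direction `i`. -/
def shifted {n : ℕ} (f : (Fin n → Bool) → Bool) (P : Finset (Fin n)) (x : Fin n → Bool)
    (i : Fin n) (w : Fin n → Bool) : Bool :=
  f (flipCoord (resetOn P x w) i)

section Certificate

variable {n : ℕ} {f : (Fin n → Bool) → Bool} {P : Finset (Fin n)} {x : Fin n → Bool} {s : ℕ}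

lemma notMem_of_shifted_ne {i k : Fin n} {w : Fin n → Bool}
    (h : shifted f P x i (flipCoord w k) ≠ shifted f P x i w) : k ∉ P :=
  fun hk => h (by rw [shifted, shifted, resetOn_flipCoord_of_mem x w hk])

lemma shifted_flipCoord {i k : Fin n} (w : Fin n → Bool) (hk : k ∉ P) :
    shifted f P x i (flipCoord w k) = f (flipCoord (flipCoord (resetOn P x w) i) k) := by
  rw [shifted, resetOn_flipCoord_of_notMem x w hk, flipCoord_comm]

lemma f_resetOn (hP : ∀ y, (∀ i ∈ P, y i = x i) → f y = false) (w : Fin n → Bool) :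
    f (resetOn P x w) = false :=
  hP _ fun _ hi => resetOn_apply_of_mem x w hi

lemma shifted_sens_le_one
    (h2 : ∀ z, f z = true → ∀ i j k, i ≠ j → i ≠ k → j ≠ k → f (flipCoord z i) = false →
      f (flipCoord z j) = false → f (flipCoord z k) = true)
    (hP : ∀ y, (∀ i ∈ P, y i = x i) → f y = false) {i : Fin n} (hi : i ∈ P) (w : Fin n → Bool)
    (hw : shifted f P x i w = true) (k l : Fin n) (hkl : k ≠ l)
    (hk : shifted f P x i (flipCoord w k) = false) :
    shifted f P x i (flipCoord w l) = true := by
  by_contra hl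
  have hkP : k ∉ P := notMem_of_shifted_ne (by rw [hk, hw]; decide)
  have hlP : l ∉ P := notMem_of_shifted_ne (by rw [hw]; exact hl)
  rw [shifted_flipCoord w hkP] at hk
  rw [shifted_flipCoord w hlP] at hl
  exact hl (h2 _ hw i k l (by rintro rfl; exact hkP hi) (by rintro rfl; exact hlP hi) hkl
    (by rw [flipCoord_flipCoord]; exact f_resetOn hP w) hk)

/-- A true point of the shifted subcube `j` that is sensitive inside it stays true under any
further flip in `P`. -/
lemma f_flip_flip_of_boundary
    (h2 : ∀ z, f z = true → ∀ i j k, i ≠ j → i ≠ k → j ≠ k → f (flipCoord z i) = false →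
      f (flipCoord z j) = false → f (flipCoord z k) = true)
    (hP : ∀ y, (∀ i ∈ P, y i = x i) → f y = false) {i j k : Fin n} (hi : i ∈ P) (hj : j ∈ P)
    (hij : i ≠ j) {w : Fin n → Bool} (hw : shifted f P x j w = true)
    (hk : shifted f P x j (flipCoord w k) = false) :
    f (flipCoord (flipCoord (resetOn P x w) i) j) = true := by
  have hkP : k ∉ P := notMem_of_shifted_ne (by rw [hk, hw]; decide)
  rw [shifted_flipCoord w hkP] at hk
  rw [flipCoord_comm]
  exact h2 _ hw j k i (by rintro rfl; exact hkP hj) hij.symm (by rintro rfl; exact hkP hi)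
    (by rw [flipCoord_flipCoord]; exact f_resetOn hP w) hk

open Classical in
/-- The indices in `P` whose shifted subcube is a literal, or has `w` as a true point
sensitive inside it. -/
noncomputable def tightIndices (f : (Fin n → Bool) → Bool) (P : Finset (Fin n))
    (x w : Fin n → Bool) : Finset (Fin n) :=
  P.filter fun i => (∃ k, IsLiteralAt (shifted f P x i) k) ∨
    (shifted f P x i w = true ∧ ∃ k, shifted f P x i (flipCoord w k) = false)

/-- The sensitive directions in `P` at the point of the subcube below `w`. -/
def sensIndices (f : (Fin n → Bool) → Bool) (P : Finset (Fin n)) (x w : Fin n → Bool) :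
    Finset (Fin n) :=
  P.filter fun i => shifted f P x i w = true

lemma card_sensIndices_le
    (hs : ∀ z, f z = false → ∀ T : Finset (Fin n), (∀ i ∈ T, f (flipCoord z i) = true) →
      T.card ≤ s)
    (hP : ∀ y, (∀ i ∈ P, y i = x i) → f y = false) (w : Fin n → Bool) :
    (sensIndices f P x w).card ≤ s :=
  hs _ (f_resetOn hP w) _ fun _ hi => (mem_filter.mp hi).2

lemma card_tightIndices_le
    (h2 : ∀ z, f z = true → ∀ i j k, i ≠ j → i ≠ k → j ≠ k → f (flipCoord z i) = false →
      f (flipCoord z j) = false → f (flipCoord z k) = true)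
    (hs : ∀ z, f z = false → ∀ T : Finset (Fin n), (∀ i ∈ T, f (flipCoord z i) = true) →
      T.card ≤ s)
    (hP : ∀ y, (∀ i ∈ P, y i = x i) → f y = false) (w : Fin n → Bool)
    (hT : (sensIndices f P x w).card = s) :
    (tightIndices f P x w).card ≤ s := by
  classical
  set T := sensIndices f P x w with hTdef
  set K := tightIndices f P x w with hKdef
  have exc : ∀ i ∈ K \ T, ∃ j ∈ T \ K, f (flipCoord (flipCoord (resetOn P x w) i) j) = false := by
    intro i hi
    obtain ⟨hiK, hiT⟩ := mem_sdiff.mp hi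
    obtain ⟨hiP, hik⟩ := mem_filter.mp hiK
    have hiw : shifted f P x i w = false := by
      by_contra hc
      exact hiT (mem_filter.mpr ⟨hiP, by simpa using hc⟩)
    obtain ⟨k, hk⟩ : ∃ k, IsLiteralAt (shifted f P x i) k := by
      rcases hik with h | h
      · exact h
      · simp [hiw] at h
    have hkt : shifted f P x i (flipCoord w k) = true := by rw [(hk w).1, hiw]; rfl
    have hkP : k ∉ P := notMem_of_shifted_ne (by rw [hkt, hiw]; decide)
    by_contra hno
    push Not at hno
    have hkT : k ∉ T := fun h => hkP (mem_filter.mp h).1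
    have := hs (flipCoord (resetOn P x w) i) hiw (insert k T) fun j hj => by
      rcases mem_insert.mp hj with rfl | hj
      · rwa [shifted_flipCoord w hkP] at hkt
      · obtain ⟨hjP, hjw⟩ := mem_filter.mp hj
        have hij : i ≠ j := by rintro rfl; exact hiT hj
        by_cases hjK : j ∈ K
        · obtain ⟨l, hl⟩ : ∃ l, shifted f P x j (flipCoord w l) = false := by
            rcases (mem_filter.mp hjK).2 with ⟨l, hl⟩ | h
            · exact ⟨l, by rw [(hl w).1, hjw]; rfl⟩
            · exact h.2
          exact f_flip_flip_of_boundary h2 hP hiP hjP hij hjw hl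
        · simpa using hno j (mem_sdiff.mpr ⟨hj, hjK⟩)
    rw [card_insert_of_notMem hkT] at this
    omega
  choose! e he using exc
  have hle : (K \ T).card ≤ (T \ K).card := by
    refine card_le_card_of_injOn e (fun i hi => (he i hi).1) fun i hi i' hi' heq => ?_
    by_contra hne
    have hi : i ∈ K \ T := hi
    have hi' : i' ∈ K \ T := hi'
    obtain ⟨hj, hf⟩ := he i hi
    have hf' := (he i' hi').2
    rw [← heq] at hf'
    have hjT := (mem_sdiff.mp hj).1
    have hjw := (mem_filter.mp hjT).2
    have ne : ∀ a ∈ K \ T, e i ≠ a := by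
      rintro a ha rfl
      exact (mem_sdiff.mp ha).2 hjT
    rw [flipCoord_comm] at hf hf'
    have := h2 _ hjw (e i) i i' (ne i hi) (ne i' hi') hne
      (by rw [flipCoord_flipCoord]; exact f_resetOn hP w) hf
    rw [hf'] at this
    exact absurd this (by decide)
  have e1 := card_sdiff_add_card_inter K T
  have e2 := card_sdiff_add_card_inter T K
  rw [inter_comm] at e2
  omega

lemma sum_card_filter_eq {α β : Type*} [Fintype α] (P : Finset β) (R : β → α → Prop)
    [∀ i, DecidablePred (R i)] [∀ w, DecidablePred fun i => R i w] :
    ∑ w, (P.filter fun i => R i w).card = ∑ i ∈ P, (univ.filter fun w => R i w).card := by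
  simp only [card_filter]
  rw [sum_comm]

/-- A minimal certificate of size at least `2 s - 2` is surrounded by literals, and each of
its points has exactly `s - 1` sensitive directions leaving the certificate. -/
lemma isLiteralAt_and_card_sensIndices
    (h2 : ∀ z, f z = true → ∀ i j k, i ≠ j → i ≠ k → j ≠ k → f (flipCoord z i) = false →
      f (flipCoord z j) = false → f (flipCoord z k) = true)
    (hs : ∀ z, f z = false → ∀ T : Finset (Fin n), (∀ i ∈ T, f (flipCoord z i) = true) →
      T.card ≤ s)
    (hP : ∀ y, (∀ i ∈ P, y i = x i) → f y = false)
    (hne : ∀ i ∈ P, ∃ w, shifted f P x i w = true)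
    (h5 : 5 ≤ s) (hm : 2 * s ≤ P.card + 2) :
    (∀ i ∈ P, ∃ k, IsLiteralAt (shifted f P x i) k) ∧
      ∀ w, (sensIndices f P x w).card + 1 = s := by
  classical
  set M := Fintype.card (Fin n → Bool) with hM
  have hMpos : 0 < M := Fintype.card_pos
  have pointwise : ∀ w, (tightIndices f P x w).card + 3 * (sensIndices f P x w).card + 3
      ≤ 3 * s + P.card := fun w => by
    have ht := card_sensIndices_le hs hP w
    have hK : (tightIndices f P x w).card ≤ P.card := card_filter_le _ _
    by_cases h : (sensIndices f P x w).card = s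
    · have := card_tightIndices_le h2 hs hP w h
      omega
    · omega
  let c : Fin n → ℕ := fun i =>
    (univ.filter fun w => (∃ k, IsLiteralAt (shifted f P x i) k) ∨
      (shifted f P x i w = true ∧ ∃ k, shifted f P x i (flipCoord w k) = false)).card
    + 3 * (univ.filter fun w => shifted f P x i w = true).card
  have total : ∑ w, ((tightIndices f P x w).card + 3 * (sensIndices f P x w).card)
      = ∑ i ∈ P, c i := by
    simp only [c, sum_add_distrib, ← mul_sum]
    congr 1
    · exact sum_card_filter_eq P _
    · congr 1
      exact sum_card_filter_eq P _
  have upper : ∑ i ∈ P, c i + 3 * M ≤ M * (3 * s + P.card) := by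
    rw [← total]
    have := sum_le_sum fun w (_ : w ∈ (univ : Finset (Fin n → Bool))) => pointwise w
    rw [sum_add_distrib] at this
    simp only [sum_const, card_univ, smul_eq_mul, ← hM] at this
    linarith
  have hlit : ∀ i ∈ P, (∃ k, IsLiteralAt (shifted f P x i) k) → 2 * c i = 5 * M := by
    rintro i - ⟨k, hk⟩
    have h := hk.two_mul_card
    have : (univ.filter fun w => (∃ k, IsLiteralAt (shifted f P x i) k) ∨
      (shifted f P x i w = true ∧ ∃ k, shifted f P x i (flipCoord w k) = false)).card = M := by
      rw [filter_true_of_mem fun w _ => Or.inl ⟨k, hk⟩, card_univ]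
    simp only [c, this]
    omega
  have hnon : ∀ i ∈ P, (¬ ∃ k, IsLiteralAt (shifted f P x i) k) → 5 * M < 2 * c i := by
    intro i hi hno
    have h1 := shifted_sens_le_one h2 hP hi
    have hb := two_mul_card_false_le h1 ((isLiteralAt_or_two_le h1 (hne i hi)).resolve_left hno)
    have hab := card_true_add_card_false (shifted f P x i)
    have hle : (univ.filter fun w => shifted f P x i w = true ∧
        ∃ k, shifted f P x i (flipCoord w k) = false).card
        ≤ (univ.filter fun w => shifted f P x i w = true).card :=
      card_le_card (monotone_filter_right _ fun w _ h => h.1)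
    simp only [c, hno, false_or]
    omega
  have hall : ∀ i ∈ P, ∃ k, IsLiteralAt (shifted f P x i) k := by
    by_contra! hex
    obtain ⟨i, hi, hno⟩ := hex
    have : ∑ i ∈ P, 5 * M < ∑ i ∈ P, 2 * c i := by
      refine sum_lt_sum (fun j hj => ?_) ⟨i, hi, hnon i hi (by push Not; exact hno)⟩
      by_cases h : ∃ k, IsLiteralAt (shifted f P x j) k
      · exact (hlit j hj h).ge
      · exact (hnon j hj h).le
    rw [sum_const, smul_eq_mul, ← mul_sum] at this
    nlinarith
  refine ⟨hall, ?_⟩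
  have hK : ∀ w, tightIndices f P x w = P := fun w =>
    filter_true_of_mem fun i hi => Or.inl (hall i hi)
  have hle : ∀ w ∈ (univ : Finset (Fin n → Bool)), (sensIndices f P x w).card + 1 ≤ s :=
    fun w _ => by
      have := pointwise w
      rw [hK] at this
      omega
  have hsum : ∑ w, ((sensIndices f P x w).card + 1) = ∑ _w : Fin n → Bool, s := by
    refine le_antisymm (sum_le_sum hle) ?_
    have h : ∑ i ∈ P, 2 * c i = P.card * (5 * M) := by
      rw [sum_congr rfl fun i hi => hlit i hi (hall i hi), sum_const, smul_eq_mul]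
    rw [← mul_sum, ← total] at h
    simp only [hK, sum_add_distrib, ← mul_sum, sum_const, card_univ, smul_eq_mul, ← hM] at h ⊢
    nlinarith
  exact fun w => (sum_eq_sum_iff_of_le hle).mp hsum w (mem_univ w)

lemma f_flip_flip_eq_false
    (h2 : ∀ z, f z = true → ∀ i j k, i ≠ j → i ≠ k → j ≠ k → f (flipCoord z i) = false →
      f (flipCoord z j) = false → f (flipCoord z k) = true)
    (hs : ∀ z, f z = false → ∀ T : Finset (Fin n), (∀ i ∈ T, f (flipCoord z i) = true) →
      T.card ≤ s)
    (hP : ∀ y, (∀ i ∈ P, y i = x i) → f y = false)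
    {κ : Fin n → Fin n} (hκ : ∀ i ∈ P, IsLiteralAt (shifted f P x i) (κ i)) {w : Fin n → Bool}
    (hT : (sensIndices f P x w).card + 1 = s) {i j : Fin n} (hi : i ∈ P) (hj : j ∈ P)
    (hij : i ≠ j) (hiw : shifted f P x i w = false) (hjw : shifted f P x j w = false) :
    f (flipCoord (flipCoord (resetOn P x w) i) j) = false := by
  classical
  by_contra hc
  have hkt : shifted f P x i (flipCoord w (κ i)) = true := by rw [(hκ i hi w).1, hiw]; rfl
  have hkP : κ i ∉ P := notMem_of_shifted_ne (by rw [hkt, hiw]; decide)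
  have hjT : j ∉ sensIndices f P x w := fun h => by simp [sensIndices, hjw] at h
  have hkT : κ i ∉ insert j (sensIndices f P x w) := fun h => by
    rcases mem_insert.mp h with h | h
    · exact hkP (h ▸ hj)
    · exact hkP (mem_filter.mp h).1
  have := hs _ hiw (insert (κ i) (insert j (sensIndices f P x w))) fun l hl => by
    rcases mem_insert.mp hl with rfl | hl
    · rwa [shifted_flipCoord w hkP] at hkt
    rcases mem_insert.mp hl with rfl | hl
    · simpa using hc
    obtain ⟨hlP, hlw⟩ := mem_filter.mp hl
    exact f_flip_flip_of_boundary h2 hP hi hlP (by rintro rfl; simp [hiw] at hlw) hlw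
      (k := κ l) (by rw [(hκ l hlP w).1, hlw]; rfl)
  rw [card_insert_of_notMem hkT, card_insert_of_notMem hjT] at this
  omega

/-- The literals around the certificate all use the same coordinate. -/
lemma literal_coord_eq
    (h2 : ∀ z, f z = true → ∀ i j k, i ≠ j → i ≠ k → j ≠ k → f (flipCoord z i) = false →
      f (flipCoord z j) = false → f (flipCoord z k) = true)
    (hs : ∀ z, f z = false → ∀ T : Finset (Fin n), (∀ i ∈ T, f (flipCoord z i) = true) →
      T.card ≤ s)
    (hP : ∀ y, (∀ i ∈ P, y i = x i) → f y = false)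
    {κ : Fin n → Fin n} (hκ : ∀ i ∈ P, IsLiteralAt (shifted f P x i) (κ i))
    (hT : ∀ w, (sensIndices f P x w).card + 1 = s) {i j : Fin n} (hi : i ∈ P) (hj : j ∈ P) :
    κ i = κ j := by
  classical
  by_contra hne
  have hij : i ≠ j := by rintro rfl; exact hne rfl
  obtain ⟨w, hiw, hjw⟩ : ∃ w, shifted f P x i w = false ∧ shifted f P x j w = false := by
    obtain ⟨w, hw⟩ : ∃ w, shifted f P x i w = false := by
      cases h : shifted f P x i x
      · exact ⟨x, h⟩
      · exact ⟨flipCoord x (κ i), by rw [(hκ i hi x).1, h]; rfl⟩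
    cases h : shifted f P x j w
    · exact ⟨w, hw, h⟩
    · exact ⟨flipCoord w (κ j), by rw [(hκ i hi w).2 _ (Ne.symm hne), hw],
        by rw [(hκ j hj w).1, h]; rfl⟩
  have notMem : ∀ a ∈ P, κ a ∉ P := fun a ha =>
    notMem_of_shifted_ne (w := w) (by rw [(hκ a ha w).1]; simp)
  have zero : ∀ {v : Fin n → Bool} {a b : Fin n}, a ∈ P → b ∈ P → a ≠ b →
      shifted f P x a v = false → shifted f P x b v = false →
      f (flipCoord (flipCoord (resetOn P x v) a) b) = false :=
    fun ha hb hab => f_flip_flip_eq_false h2 hs hP hκ (hT _) ha hb hab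
  have one : ∀ {v : Fin n → Bool} {a b : Fin n}, a ∈ P → b ∈ P → a ≠ b →
      shifted f P x b v = true → f (flipCoord (flipCoord (resetOn P x v) a) b) = true :=
    fun ha hb hab hbv => f_flip_flip_of_boundary h2 hP ha hb hab hbv (k := κ _)
      (by rw [(hκ _ hb _).1, hbv]; rfl)
  have sensκ : ∀ {a b : Fin n}, a ∈ P → b ∈ P → a ≠ b → shifted f P x b w = false →
      f (flipCoord (flipCoord (flipCoord (resetOn P x w) a) b) (κ b)) = true := by
    intro a b ha hb hab hbw
    have := one (v := flipCoord w (κ b)) ha hb hab (by rw [(hκ b hb w).1, hbw]; rfl)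
    rwa [resetOn_flipCoord_of_notMem x w (notMem b hb), flipCoord_comm _ (κ b) a,
      flipCoord_comm _ (κ b) b] at this
  have triple : ∀ {a b l : Fin n}, a ∈ P → b ∈ P → l ∈ P → a ≠ b → a ≠ l → b ≠ l →
      κ l ≠ κ a → shifted f P x a w = false → shifted f P x l w = true →
      f (flipCoord (flipCoord (flipCoord (resetOn P x w) a) b) l) = true := by
    intro a b l ha hb hl hab hal hbl hk haw hlw
    have hz := zero (v := flipCoord w (κ l)) ha hl hal
      (by rw [(hκ a ha w).2 _ hk, haw]) (by rw [(hκ l hl w).1, hlw]; rfl)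
    rw [resetOn_flipCoord_of_notMem x w (notMem l hl), flipCoord_comm _ (κ l) a,
      flipCoord_comm _ (κ l) l] at hz
    rw [flipCoord_comm _ b l]
    exact h2 _ (one ha hl hal hlw) l (κ l) b (by intro h; exact notMem l hl (h ▸ hl))
      hbl.symm (by intro h; exact notMem l hl (h ▸ hb)) (by rw [flipCoord_flipCoord]; exact haw) hz
  have hjT : κ j ∉ sensIndices f P x w := fun h => notMem j hj (mem_filter.mp h).1
  have hiT : κ i ∉ insert (κ j) (sensIndices f P x w) := fun h => by
    rcases mem_insert.mp h with h | h
    · exact hne h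
    · exact notMem i hi (mem_filter.mp h).1
  have := hs _ (zero hi hj hij hiw hjw) (insert (κ i) (insert (κ j) (sensIndices f P x w)))
    fun l hl => by
      rcases mem_insert.mp hl with rfl | hl
      · rw [flipCoord_comm _ i j]
        exact sensκ hj hi hij.symm hiw
      rcases mem_insert.mp hl with rfl | hl
      · exact sensκ hi hj hij hjw
      obtain ⟨hlP, hlw⟩ := mem_filter.mp hl
      have hil : i ≠ l := by rintro rfl; simp [hiw] at hlw
      have hjl : j ≠ l := by rintro rfl; simp [hjw] at hlw
      by_cases hk : κ l = κ i
      · rw [flipCoord_comm _ i j]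
        exact triple hj hi hlP hij.symm hjl hil (by rw [hk]; exact hne) hjw hlw
      · exact triple hi hj hlP hij hil hjl hk hiw hlw
  rw [card_insert_of_notMem hiT, card_insert_of_notMem hjT] at this
  have := hT w
  omega

/-- When all literals use the coordinate `k`, fixing `k` and the sensitive directions at `x`
is already a certificate. -/
lemma f_eq_false_of_agree
    (h2 : ∀ z, f z = true → ∀ i j k, i ≠ j → i ≠ k → j ≠ k → f (flipCoord z i) = false →
      f (flipCoord z j) = false → f (flipCoord z k) = true)
    (hs : ∀ z, f z = false → ∀ T : Finset (Fin n), (∀ i ∈ T, f (flipCoord z i) = true) →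
      T.card ≤ s)
    (hP : ∀ y, (∀ i ∈ P, y i = x i) → f y = false) {k : Fin n}
    (hk : ∀ i ∈ P, IsLiteralAt (shifted f P x i) k)
    (hT : ∀ w, (sensIndices f P x w).card + 1 = s) (y : Fin n → Bool)
    (hy : ∀ i ∈ insert k (sensIndices f P x x), y i = x i) : f y = false := by
  classical
  induction hc : (P.filter fun i => y i ≠ x i).card using Nat.strong_induction_on generalizing y with
  | _ c ih =>
  set R := P.filter fun i => y i ≠ x i with hR
  have low : ∀ i ∈ R, shifted f P x i y = false := by
    intro i hi
    obtain ⟨hiP, hiy⟩ := mem_filter.mp hi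
    have hix : shifted f P x i x = false := by
      by_contra h
      exact hiy (hy i (mem_insert_of_mem (mem_filter.mpr ⟨hiP, by simpa using h⟩)))
    refine flipCoord_induction (w₀ := x) (Q := fun v => shifted f P x i v = false)
      (L := fun l => l ≠ k) hix (fun w l hl hw => ?_) y fun l hl => ?_
    · rw [(hk i hiP w).2 l hl, hw]
    · rw [not_not.mp hl]
      exact hy k (mem_insert_self _ _)
  have flipped : ∀ i ∈ R, f (flipCoord y i) = false := by
    intro i hi
    obtain ⟨hiP, hiy⟩ := mem_filter.mp hi
    refine ih _ ?_ (flipCoord y i) (fun l hl => ?_) rfl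
    · rw [← hc]
      refine card_lt_card ⟨fun l hl => ?_, fun h => ?_⟩
      · simp only [mem_filter, flipCoord_apply] at hl
        simp only [hR, mem_filter]
        grind
      · have := (mem_filter.mp (h hi)).2
        rw [flipCoord_apply, if_pos rfl] at this
        exact this (Bool.eq_not.mpr hiy.symm).symm
    · have hli : l ≠ i := by rintro rfl; exact hiy (hy l hl)
      rw [flipCoord_apply, if_neg hli]
      exact hy l hl
  by_contra hf
  have hf : f y = true := by simpa using hf
  have hmem : ∀ l, l ∈ R ↔ l ∈ P ∧ y l ≠ x l := fun l => by simp [hR]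
  rcases Nat.lt_or_ge 2 R.card with h | h
  · obtain ⟨a, ha, b, hb, d, hd, hab, had, hbd⟩ := two_lt_card.mp h
    have := h2 y hf a b d hab had hbd (flipped a ha) (flipped b hb)
    simp [flipped d hd] at this
  interval_cases hcard : R.card
  · rw [card_eq_zero] at hcard
    have := hP y fun i hi => by
      by_contra h
      simpa [hcard] using (hmem i).mpr ⟨hi, h⟩
    simp [this] at hf
  · obtain ⟨a, ha⟩ := card_eq_one.mp hcard
    have haR : a ∈ R := by simp [ha]
    have haa := (hmem a).mp haR
    have hya : flipCoord (resetOn P x y) a = y := by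
      refine flipCoord_resetOn_eq haa.2 (fun j hj hja => ?_) haa.1
      by_contra h
      exact hja (by simpa [ha] using (hmem j).mpr ⟨hj, h⟩)
    have := low a haR
    rw [shifted, hya, hf] at this
    exact absurd this (by decide)
  · obtain ⟨a, b, hab, hR2⟩ := card_eq_two.mp hcard
    have haR : a ∈ R := by simp [hR2]
    have hbR : b ∈ R := by simp [hR2]
    have haa := (hmem a).mp haR
    have hbb := (hmem b).mp hbR
    have hyab : flipCoord (flipCoord (resetOn P x y) a) b = y := by
      have hya : flipCoord (resetOn P x (flipCoord y b)) a = flipCoord y b := by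
        refine flipCoord_resetOn_eq ?_ (fun j hj hja => ?_) haa.1
        · rw [flipCoord_apply, if_neg hab]
          exact haa.2
        · rw [flipCoord_apply]
          split_ifs with hjb
          · rw [hjb]
            exact (Bool.eq_not.mpr hbb.2.symm).symm
          · by_contra h
            have := (hmem j).mpr ⟨hj, h⟩
            simp [hR2, hja, hjb] at this
      rw [resetOn_flipCoord_of_mem x y hbb.1] at hya
      rw [hya, flipCoord_flipCoord]
    have := f_flip_flip_eq_false h2 hs hP (κ := fun _ => k) hk (hT y) haa.1 hbb.1 hab
      (low a haR) (low b hbR)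
    rw [hyab, hf] at this
    exact absurd this (by decide)

end Certificate

lemma certAt_le_card {n : ℕ} {f : (Fin n → Bool) → Bool} {x : Fin n → Bool} {P : Finset (Fin n)}
    (hP : ∀ y, (∀ i ∈ P, y i = x i) → f y = f x) : certAt f x ≤ P.card :=
  Nat.sInf_le ⟨P, rfl, hP⟩

lemma exists_card_eq_certAt {n : ℕ} (f : (Fin n → Bool) → Bool) (x : Fin n → Bool) :
    ∃ P : Finset (Fin n), P.card = certAt f x ∧ ∀ y, (∀ i ∈ P, y i = x i) → f y = f x :=
  Nat.sInf_mem (s := {k | ∃ P : Finset (Fin n), P.card = k ∧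
    ∀ y : Fin n → Bool, (∀ i ∈ P, y i = x i) → f y = f x})
    ⟨_, univ, rfl, fun _ hy => congrArg f (funext fun i => hy i (mem_univ i))⟩

lemma card_le_bSens {n : ℕ} {f : (Fin n → Bool) → Bool} {b : Bool} {z : Fin n → Bool}
    (hz : f z = b) (T : Finset (Fin n)) (hT : ∀ i ∈ T, f (flipCoord z i) ≠ b) :
    T.card ≤ bSens f b := by
  have h1 : sensAt f z ≤ bSens f b := le_sup (f := sensAt f) (by simpa using hz)
  exact (card_le_card fun i hi => by simpa [hz] using hT i hi).trans h1

/-- **Theorem 11.** If `f` is non-constant with `s₁(f) = 2` and `s₀(f) ≥ 5`,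
then `C₀(f) ≤ 2·s₀(f) − 3`. -/
theorem cert0_le_two_sens0_sub_three {n : ℕ} (f : (Fin n → Bool) → Bool)
    (hnc : NonConstant f) (hs1 : bSens f true = 2) (hs0 : 5 ≤ bSens f false) :
    bCert f false ≤ 2 * bSens f false - 3 := by
  classical
  refine Finset.sup_le fun x hx => ?_
  have hx : f x = false := by simpa using hx
  by_contra hlt
  obtain ⟨P, hPcard, hPx⟩ := exists_card_eq_certAt f x
  have hP : ∀ y, (∀ i ∈ P, y i = x i) → f y = false := fun y hy => (hPx y hy).trans hx
  have h2 : ∀ z, f z = true → ∀ i j k, i ≠ j → i ≠ k → j ≠ k → f (flipCoord z i) = false →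
      f (flipCoord z j) = false → f (flipCoord z k) = true := by
    intro z hz i j k hij hik hjk hi hj
    by_contra hk
    have := card_le_bSens hz {i, j, k} (by simp [hi, hj, hk])
    rw [hs1, card_eq_three.mpr ⟨i, j, k, hij, hik, hjk, rfl⟩] at this
    omega
  have hs : ∀ z, f z = false → ∀ T : Finset (Fin n), (∀ i ∈ T, f (flipCoord z i) = true) →
      T.card ≤ bSens f false := fun z hz T hT => card_le_bSens hz T fun i hi => by simp [hT i hi]
  have hne : ∀ i ∈ P, ∃ w, shifted f P x i w = true := by
    intro i hi
    by_contra! hno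
    have := certAt_le_card (f := f) (x := x) (P := P.erase i) fun y hy => by
      rw [hx]
      by_cases hyi : y i = x i
      · exact hP y fun j hj => by
          by_cases hji : j = i
          · rw [hji, hyi]
          · exact hy j (mem_erase.mpr ⟨hji, hj⟩)
      · have hflip : flipCoord (resetOn P x y) i = y :=
          flipCoord_resetOn_eq hyi (fun j hj hji => hy j (mem_erase.mpr ⟨hji, hj⟩)) hi
        have := hno y
        rw [shifted, hflip] at this
        simpa using this
    have h1 := card_erase_lt_of_mem hi
    omega
  obtain ⟨hlit, hT⟩ := isLiteralAt_and_card_sensIndices h2 hs hP hne hs0 (by omega)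
  obtain ⟨i₀, hi₀⟩ : P.Nonempty := card_pos.mp (by omega)
  have : Nonempty (Fin n) := ⟨i₀⟩
  choose! κ hκ using hlit
  have hk : ∀ i ∈ P, IsLiteralAt (shifted f P x i) (κ i₀) := fun i hi =>
    literal_coord_eq h2 hs hP hκ hT hi₀ hi ▸ hκ i hi
  have := certAt_le_card (f := f) (x := x) fun y hy =>
    (f_eq_false_of_agree h2 hs hP hk hT y hy).trans hx.symm
  have h1 := card_insert_le (κ i₀) (sensIndices f P x x)
  have h3 := hT x
  omega
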